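/- Let H be an N×M random matrix (M ≤ N) whose entries are i.i.d. circularly-symmetric complex Gaussian with mean zero and unit variance, with singular values σ₁ ≤ σ₂ ≤ … ≤ σ_M. Then lim_{ε→0+} log Pr{σ₁ ≤ ε^M/(4√M) and σ_i ≤ 1/(4√M) for all i > 1} / log ε = 2M(N−M+1). -/

import Mathlib

open MeasureTheory ProbabilityTheory Matrix Filter Set

noncomputable section

/-- Euclidean norm of a complex vector indexed by a finite type. -/
def cnorm {ι : Type*} [Fintype ι] (v : ι → ℂ) : ℝ :=
  Real.sqrt (∑ i, ‖v i‖ ^ 2)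

/-- Minimum distance of the complex lattice generated by the columns of `G`
(over the Gaussian integers): `d(G) = inf {‖G z‖ : z ∈ ℤ[i]^κ, z ≠ 0}`. -/
def latMinDist {ι κ : Type*} [Fintype ι] [Fintype κ] (G : Matrix ι κ ℂ) : ℝ :=
  sInf {r | ∃ z : κ → GaussianInt, z ≠ 0 ∧ r = cnorm (G.mulVec fun j => (z j : ℂ))}

/-- Sample space measure for an `N × M` i.i.d. circularly-symmetric complex Gaussian
matrix of unit entry variance: each of the `2NM` real coordinates is an independent
real Gaussian of mean `0` and variance `1/2`. -/
def gaussMatMeasure (N M : ℕ) : Measure ((Fin N × Fin M × Bool) → ℝ) :=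
  Measure.pi fun _ => gaussianReal 0 (1/2)

/-- The complex matrix built from a sample of real coordinates
(`false` ↦ real part, `true` ↦ imaginary part). -/
def matOf {N M : ℕ} (g : (Fin N × Fin M × Bool) → ℝ) : Matrix (Fin N) (Fin M) ℂ :=
  fun i j => (g (i, j, false) : ℂ) + (g (i, j, true) : ℂ) * Complex.I

section aux

abbrev mu0 : Measure ℝ := gaussianReal 0 (1/2)

lemma mu0_upper (x t : ℝ) (ht : 0 ≤ t) :
    mu0 (Icc (x - t) (x + t)) ≤ ENNReal.ofReal (2 * t) := by
  rw [gaussianReal_apply _ (by norm_num)]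
  calc ∫⁻ y in Icc (x - t) (x + t), gaussianPDF 0 (1/2) y
      ≤ ∫⁻ y in Icc (x - t) (x + t), 1 := by
        apply setLIntegral_mono measurable_const
        intro y _
        rw [gaussianPDF, gaussianPDFReal_def]
        apply ENNReal.ofReal_le_one.2
        have h1 : Real.exp (-(y - 0) ^ 2 / (2 * ((1/2 : NNReal) : ℝ))) ≤ 1 := by
          apply Real.exp_le_one_iff.2
          apply div_nonpos_of_nonpos_of_nonneg
          · nlinarith [sq_nonneg (y - 0)]
          · positivity
        have h2 : (√(2 * Real.pi * ((1/2 : NNReal) : ℝ)))⁻¹ ≤ 1 := by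
          apply inv_le_one_of_one_le₀
          apply Real.one_le_sqrt.2
          push_cast
          nlinarith [Real.pi_gt_three]
        exact mul_le_one₀ h2 (Real.exp_pos _).le h1
    _ = ENNReal.ofReal (2 * t) := by
        rw [setLIntegral_const, Real.volume_Icc, one_mul]
        congr 1; ring

lemma mu0_lower : ∃ k : ℝ, 0 < k ∧ ∀ x t : ℝ, |x| ≤ 1 → 0 ≤ t → t ≤ 1 →
    ENNReal.ofReal (k * t) ≤ mu0 (Icc (x - t) (x + t)) := by
  refine ⟨(√(2 * Real.pi * ((1/2 : NNReal) : ℝ)))⁻¹ * Real.exp (-4) * 2, ?_, ?_⟩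
  · have : 0 < √(2 * Real.pi * ((1/2 : NNReal) : ℝ)) := by
      apply Real.sqrt_pos.2
      push_cast
      positivity
    positivity
  intro x t hx ht ht1
  rw [gaussianReal_apply _ (by norm_num)]
  calc _ = ∫⁻ y in Icc (x - t) (x + t),
          ENNReal.ofReal ((√(2 * Real.pi * ((1/2 : NNReal) : ℝ)))⁻¹ * Real.exp (-4)) := by
        rw [setLIntegral_const, Real.volume_Icc, ← ENNReal.ofReal_mul (by positivity)]
        congr 1; ring
    _ ≤ _ := by
        apply setLIntegral_mono (measurable_gaussianPDF _ _)
        intro y hy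
        rw [gaussianPDF, gaussianPDFReal_def]
        apply ENNReal.ofReal_le_ofReal
        apply mul_le_mul_of_nonneg_left _ (by positivity)
        apply Real.exp_le_exp.2
        push_cast
        rw [abs_le] at hx
        have := hy.1
        have := hy.2
        have : y ^ 2 ≤ 4 := by nlinarith
        norm_num
        linarith

/-- coordinatewise merge -/
def mrg {ι : Type*} (p : ι → Prop) [DecidablePred p] (g g' : ι → ℝ) : ι → ℝ :=
  fun i => if p i then g i else g' i

abbrev muI (ι : Type*) [Fintype ι] : Measure (ι → ℝ) := Measure.pi fun _ => mu0

lemma measurable_mrg {ι : Type*} (p : ι → Prop) [DecidablePred p] :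
    Measurable (fun z : (ι → ℝ) × (ι → ℝ) => mrg p z.2 z.1) := by
  apply measurable_pi_lambda
  intro i
  unfold mrg
  by_cases h : p i
  · simp only [h, if_true]; fun_prop
  · simp only [h, if_false]; fun_prop

lemma map_mrg {ι : Type*} [Fintype ι] (p : ι → Prop) [DecidablePred p] :
    ((muI ι).prod (muI ι)).map (fun z : (ι → ℝ) × (ι → ℝ) => mrg p z.2 z.1) = muI ι := by
  symm
  apply Measure.pi_eq
  intro s hs
  rw [Measure.map_apply (measurable_mrg p) (MeasurableSet.univ_pi hs)]
  have : (fun z : (ι → ℝ) × (ι → ℝ) => mrg p z.2 z.1) ⁻¹' (Set.univ.pi s) =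
      (Set.univ.pi fun i => if p i then univ else s i) ×ˢ
      (Set.univ.pi fun i => if p i then s i else univ) := by
    ext ⟨a, b⟩
    simp only [mem_preimage, mem_univ_pi, mem_prod, mrg]
    rw [← forall_and]
    apply forall_congr'
    intro i
    by_cases h : p i <;> simp [h]
  rw [this, Measure.prod_prod, Measure.pi_pi, Measure.pi_pi, ← Finset.prod_mul_distrib]
  apply Finset.prod_congr rfl
  intro i _
  by_cases h : p i <;> simp [h]

lemma fub_upper {ι : Type*} [Fintype ι] (p : ι → Prop) [DecidablePred p] (A : Set (ι → ℝ))
    (hA : MeasurableSet A) (C : ENNReal) (h : ∀ g', muI ι {g | mrg p g g' ∈ A} ≤ C) :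
    muI ι A ≤ C := by
  rw [← map_mrg p, Measure.map_apply (measurable_mrg p) hA,
    Measure.prod_apply (measurable_mrg p hA)]
  calc _ ≤ ∫⁻ _, C ∂(muI ι) := lintegral_mono fun g' => h g'
    _ = C := by simp

lemma fub_lower {ι : Type*} [Fintype ι] (p : ι → Prop) [DecidablePred p] (A B : Set (ι → ℝ))
    (hB : MeasurableSet B)
    (C : ENNReal) (h : ∀ g' ∈ B, C ≤ muI ι {g | mrg p g g' ∈ A}) :
    C * muI ι B ≤ muI ι A := by
  rw [← measure_toMeasurable A]
  set T := toMeasurable (muI ι) A with hT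
  have hTm : MeasurableSet T := measurableSet_toMeasurable _ _
  conv_rhs => rw [← map_mrg p, Measure.map_apply (measurable_mrg p) hTm,
    Measure.prod_apply (measurable_mrg p hTm)]
  calc C * muI ι B = ∫⁻ _ in B, C ∂(muI ι) := by rw [setLIntegral_const]
    _ ≤ ∫⁻ g' in B, muI ι {g | mrg p g g' ∈ T} ∂(muI ι) := by
        apply setLIntegral_mono' hB
        intro g' hg'
        exact (h g' hg').trans (measure_mono fun g hg => subset_toMeasurable _ _ hg)
    _ ≤ _ := setLIntegral_le_lintegral _ _

lemma box_meas {ι : Type*} [Fintype ι] (q : ι → Prop) [DecidablePred q] (I : ι → Set ℝ) :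
    muI ι {g | ∀ i, q i → g i ∈ I i} = ∏ i with q i, mu0 (I i) := by
  have : {g : ι → ℝ | ∀ i, q i → g i ∈ I i} = Set.univ.pi fun i => if q i then I i else univ := by
    ext g
    simp only [mem_ofPred_eq, mem_univ_pi]
    apply forall_congr'
    intro i
    by_cases h : q i <;> simp [h]
  rw [this, Measure.pi_pi, Finset.prod_filter]
  apply Finset.prod_congr rfl
  intro i _
  by_cases h : q i <;> simp [h]

lemma box_upper {ι : Type*} [Fintype ι] (q : ι → Prop) [DecidablePred q] (I : ι → Set ℝ)
    (a : ENNReal) (h : ∀ i, q i → mu0 (I i) ≤ a) :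
    muI ι {g | ∀ i, q i → g i ∈ I i} ≤ a ^ (Finset.univ.filter q).card := by
  rw [box_meas]
  apply Finset.prod_le_pow_card
  intro i hi
  exact h i (Finset.mem_filter.1 hi).2

lemma box_lower {ι : Type*} [Fintype ι] (q : ι → Prop) [DecidablePred q] (I : ι → Set ℝ)
    (a : ENNReal) (h : ∀ i, q i → a ≤ mu0 (I i)) :
    a ^ (Finset.univ.filter q).card ≤ muI ι {g | ∀ i, q i → g i ∈ I i} := by
  rw [box_meas, ← Finset.prod_const]
  apply Finset.prod_le_prod'
  intro i hi
  exact h i (Finset.mem_filter.1 hi).2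

section linalg
variable {N M : ℕ}

lemma star_dot_self {n : ℕ} (u : Fin n → ℂ) : star u ⬝ᵥ u = ((∑ i, ‖u i‖ ^ 2 : ℝ) : ℂ) := by
  simp only [dotProduct, Pi.star_apply]
  push_cast
  apply Finset.sum_congr rfl
  intro i _
  exact Complex.conj_mul' (u i)

lemma quad_form (H : Matrix (Fin N) (Fin M) ℂ) (v : Fin M → ℂ) :
    star v ⬝ᵥ ((Hᴴ * H) *ᵥ v) = ((∑ i, ‖(H *ᵥ v) i‖ ^ 2 : ℝ) : ℂ) := by
  rw [← star_dot_self, ← Matrix.mulVec_mulVec, Matrix.dotProduct_mulVec, Matrix.star_mulVec]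

lemma sum_sq_eq (H : Matrix (Fin N) (Fin M) ℂ) (σ : Fin M → ℝ)
    (hchar : (Hᴴ * H).charpoly = ∏ i, (Polynomial.X - Polynomial.C ((σ i : ℂ) ^ 2))) :
    ∑ i, ∑ k, ‖H i k‖ ^ 2 = ∑ i, σ i ^ 2 := by
  have h1 := Matrix.trace_eq_sum_roots_charpoly (Hᴴ * H)
  have h2 : (∏ i, (Polynomial.X - Polynomial.C ((σ i : ℂ) ^ 2))).roots =
      Finset.univ.val.map (fun i => (σ i : ℂ) ^ 2) := by
    rw [← Polynomial.roots_multiset_prod_X_sub_C (Finset.univ.val.map (fun i => (σ i : ℂ) ^ 2)),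
      Multiset.map_map]
    rfl
  rw [hchar, h2] at h1
  have h3 : (Hᴴ * H).trace = ((∑ i, ∑ k, ‖H i k‖ ^ 2 : ℝ) : ℂ) := by
    rw [Finset.sum_comm]
    simp only [Matrix.trace, Matrix.diag, Matrix.mul_apply, Matrix.conjTranspose_apply]
    push_cast
    apply Finset.sum_congr rfl
    intro i _
    apply Finset.sum_congr rfl
    intro k _
    exact Complex.conj_mul' _
  rw [h3] at h1
  have h4 : ((Finset.univ.val.map (fun i => (σ i : ℂ) ^ 2)).sum) = ((∑ i, σ i ^ 2 : ℝ) : ℂ) := by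
    push_cast; rfl
  rw [h4] at h1
  exact_mod_cast h1

lemma exists_vec (H : Matrix (Fin N) (Fin M) ℂ) (σ : Fin M → ℝ)
    (hchar : (Hᴴ * H).charpoly = ∏ i, (Polynomial.X - Polynomial.C ((σ i : ℂ) ^ 2))) (j : Fin M) :
    ∃ v : Fin M → ℂ, v ≠ 0 ∧ ∑ i, ‖(H *ᵥ v) i‖ ^ 2 = σ j ^ 2 * ∑ k, ‖v k‖ ^ 2 := by
  have h0 : (Matrix.scalar (Fin M) ((σ j : ℂ) ^ 2) - Hᴴ * H).det = 0 := by
    rw [← Matrix.eval_charpoly, hchar, Polynomial.eval_prod]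
    apply Finset.prod_eq_zero (Finset.mem_univ j)
    simp
  obtain ⟨v, hv, hv2⟩ := Matrix.exists_mulVec_eq_zero_iff.2 h0
  refine ⟨v, hv, ?_⟩
  have h1 : (Hᴴ * H) *ᵥ v = ((σ j : ℂ) ^ 2) • v := by
    rw [Matrix.sub_mulVec, sub_eq_zero] at hv2
    rw [← hv2]
    simp [Matrix.scalar_apply, ← Matrix.smul_one_eq_diagonal, Matrix.smul_mulVec]
  have h2 := quad_form H v
  rw [h1, dotProduct_smul, star_dot_self, smul_eq_mul] at h2
  exact_mod_cast h2.symm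

open scoped ComplexOrder in
lemma rayleigh (H : Matrix (Fin N) (Fin M) ℂ) (σ : Fin M → ℝ)
    (hchar : (Hᴴ * H).charpoly = ∏ i, (Polynomial.X - Polynomial.C ((σ i : ℂ) ^ 2)))
    (s : ℝ) (hs : ∀ i, s ≤ σ i ^ 2) (v : Fin M → ℂ) :
    s * ∑ k, ‖v k‖ ^ 2 ≤ ∑ i, ‖(H *ᵥ v) i‖ ^ 2 := by
  have hA : (Hᴴ * H - (s : ℂ) • (1 : Matrix (Fin M) (Fin M) ℂ)).IsHermitian := by
    apply Matrix.IsHermitian.sub (Matrix.isHermitian_conjTranspose_mul_self H)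
    rw [Matrix.IsHermitian, Matrix.conjTranspose_smul]
    simp
  have hP : (Hᴴ * H - (s : ℂ) • (1 : Matrix (Fin M) (Fin M) ℂ)).PosSemidef := by
    rw [hA.posSemidef_iff_eigenvalues_nonneg]
    intro j
    set lam := hA.eigenvalues j
    have h1 := hA.mulVec_eigenvectorBasis j
    set w := (hA.eigenvectorBasis j).ofLp with hw
    have hw0 : w ≠ 0 := by
      intro h
      apply hA.eigenvectorBasis.orthonormal.ne_zero j
      ext i
      exact congrFun h i
    have h2 : (Matrix.scalar (Fin M) ((s + lam : ℝ) : ℂ) - Hᴴ * H).det = 0 := by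
      apply Matrix.exists_mulVec_eq_zero_iff.1
      refine ⟨w, hw0, ?_⟩
      rw [Matrix.sub_mulVec, Matrix.smul_mulVec, Matrix.one_mulVec, sub_eq_iff_eq_add] at h1
      rw [Matrix.sub_mulVec, h1]
      ext i
      simp [Matrix.scalar_apply, ← Matrix.smul_one_eq_diagonal, Matrix.smul_mulVec]
      simp only [lam]
      ring
    rw [← Matrix.eval_charpoly, hchar, Polynomial.eval_prod] at h2
    obtain ⟨i, -, hi⟩ := Finset.prod_eq_zero_iff.1 h2
    simp only [Polynomial.eval_sub, Polynomial.eval_X, Polynomial.eval_C] at hi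
    have h3 : s + lam = σ i ^ 2 := by
      have := sub_eq_zero.1 hi
      exact_mod_cast this
    have := hs i
    simp only [Pi.zero_apply]
    linarith
  have h := hP.re_dotProduct_nonneg v
  rw [Matrix.sub_mulVec, Matrix.smul_mulVec, Matrix.one_mulVec, dotProduct_sub, quad_form,
    dotProduct_smul, star_dot_self, smul_eq_mul] at h
  have h5 : (RCLike.re (((∑ i, ‖(H *ᵥ v) i‖ ^ 2 : ℝ) : ℂ) - (s : ℂ) * ((∑ k, ‖v k‖ ^ 2 : ℝ) : ℂ)) : ℝ)
      = (∑ i, ‖(H *ᵥ v) i‖ ^ 2) - s * ∑ k, ‖v k‖ ^ 2 := by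
    rw [← Complex.ofReal_mul, ← Complex.ofReal_sub]
    exact Complex.ofReal_re _
  rw [h5] at h
  linarith

lemma normalize_vec (v : Fin M → ℂ) (hv : v ≠ 0) :
    ∃ j, ∃ a : ℂ, a ≠ 0 ∧ (a • v) j = 1 ∧ ∀ k, ‖(a • v) k‖ ≤ 1 := by
  obtain ⟨k0, hk0⟩ := Function.ne_iff.1 hv
  obtain ⟨j, -, hj⟩ := Finset.exists_max_image Finset.univ (fun k => ‖v k‖) ⟨k0, Finset.mem_univ _⟩
  have hpos : 0 < ‖v j‖ := lt_of_lt_of_le (norm_pos_iff.2 hk0) (hj k0 (Finset.mem_univ _))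
  have hj0 : v j ≠ 0 := norm_pos_iff.1 hpos
  refine ⟨j, (v j)⁻¹, inv_ne_zero hj0, by simp [hj0], fun k => ?_⟩
  simp only [Pi.smul_apply, smul_eq_mul, norm_mul, norm_inv]
  rw [inv_mul_le_iff₀ hpos, mul_one]
  exact hj k (Finset.mem_univ _)

/-- real/imag part of `(Hv)_i` -/
def lin (v : Fin M → ℂ) (g : (Fin N × Fin M × Bool) → ℝ) (i : Fin N) (b : Bool) : ℝ :=
  if b then ((matOf g *ᵥ v) i).im else ((matOf g *ᵥ v) i).re

lemma lin_eq (v : Fin M → ℂ) (j : Fin M) (hj : v j = 1) (g : (Fin N × Fin M × Bool) → ℝ)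
    (i : Fin N) : (matOf g *ᵥ v) i = matOf g i j + ∑ k ∈ Finset.univ.erase j, matOf g i k * v k := by
  rw [Matrix.mulVec, dotProduct, ← Finset.add_sum_erase _ _ (Finset.mem_univ j), hj, mul_one]

lemma matOf_re (g : (Fin N × Fin M × Bool) → ℝ) (i j) : (matOf g i j).re = g (i, j, false) := by
  simp [matOf]

lemma matOf_im (g : (Fin N × Fin M × Bool) → ℝ) (i j) : (matOf g i j).im = g (i, j, true) := by
  simp [matOf]

lemma lin_diff (v : Fin M → ℂ) (j : Fin M) (hj : v j = 1) (g g' : (Fin N × Fin M × Bool) → ℝ)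
    (i : Fin N) (h : ∀ k b, k ≠ j → g (i, k, b) = g' (i, k, b)) (b : Bool) :
    lin v g i b - g (i, j, b) = lin v g' i b - g' (i, j, b) := by
  have hs : ∑ k ∈ Finset.univ.erase j, matOf g i k * v k
      = ∑ k ∈ Finset.univ.erase j, matOf g' i k * v k := by
    apply Finset.sum_congr rfl
    intro k hk
    have hk := Finset.ne_of_mem_erase hk
    simp [matOf, h k _ hk]
  unfold lin
  rw [lin_eq v j hj, lin_eq v j hj, hs]
  cases b <;> simp [matOf_re, matOf_im]

lemma abs_lin_le (v : Fin M → ℂ) (g : (Fin N × Fin M × Bool) → ℝ) (i : Fin N) (b : Bool) :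
    |lin v g i b| ≤ ‖(matOf g *ᵥ v) i‖ := by
  unfold lin
  cases b
  · simpa using Complex.abs_re_le_norm _
  · simpa using Complex.abs_im_le_norm _

lemma norm_sq_lin (v : Fin M → ℂ) (g : (Fin N × Fin M × Bool) → ℝ) (i : Fin N) :
    ‖(matOf g *ᵥ v) i‖ ^ 2 = lin v g i false ^ 2 + lin v g i true ^ 2 := by
  rw [← Complex.normSq_eq_norm_sq, Complex.normSq_apply]
  simp [lin, sq]

lemma continuous_lin (v : Fin M → ℂ) (i : Fin N) (b : Bool) : Continuous fun g => lin v g i b := by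
  unfold lin matOf Matrix.mulVec dotProduct
  cases b <;> simp <;> fun_prop

end linalg

section bounds
variable {N M : ℕ}

lemma norm_matOf_le (g : (Fin N × Fin M × Bool) → ℝ) (i k) (a : ℝ)
    (h : ∀ b, |g (i, k, b)| ≤ a) : ‖matOf g i k‖ ≤ 2 * a := by
  have := Complex.norm_le_abs_re_add_abs_im (matOf g i k)
  rw [matOf_re, matOf_im] at this
  linarith [h false, h true]

lemma norm_mulVec_le (H : Matrix (Fin N) (Fin M) ℂ) (v : Fin M → ℂ) (i : Fin N) (a c : ℝ)
    (ha : 0 ≤ a) (h : ∀ k, ‖H i k‖ ≤ a) (hv : ∀ k, ‖v k‖ ≤ c) : ‖(H *ᵥ v) i‖ ≤ M * (a * c) := by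
  rw [Matrix.mulVec, dotProduct]
  calc _ ≤ ∑ k, ‖H i k * v k‖ := norm_sum_le _ _
    _ ≤ ∑ k : Fin M, a * c := by
      apply Finset.sum_le_sum
      intro k _
      rw [norm_mul]
      exact mul_le_mul (h k) (hv k) (norm_nonneg _) ha
    _ = _ := by simp

lemma lin_congr (v : Fin M → ℂ) (g g' : (Fin N × Fin M × Bool) → ℝ)
    (i : Fin N) (h : ∀ k b, g (i, k, b) = g' (i, k, b)) (b : Bool) :
    lin v g i b = lin v g' i b := by
  unfold lin matOf Matrix.mulVec dotProduct
  simp only [h]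

lemma card_col (j : Fin M) :
    (Finset.univ.filter fun z : Fin N × Fin M × Bool => z.2.1 = j).card = 2 * N := by
  have : (Finset.univ.filter fun z : Fin N × Fin M × Bool => z.2.1 = j) =
      Finset.univ ×ˢ ({j} ×ˢ Finset.univ) := by
    ext ⟨a, b, c⟩
    cases c <;> simp
  rw [this, Finset.card_product, Finset.card_product]
  simp [mul_comm]

lemma card_row (hM : 0 < M) (hMN : M ≤ N) :
    (Finset.univ.filter fun i : Fin N => ¬ (i.val < M - 1)).card = N - M + 1 := by
  have h1 := Finset.card_filter_add_card_filter_not (s := (Finset.univ : Finset (Fin N))) (fun i : Fin N => i.val < M - 1)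
  have h2 : (Finset.univ.filter fun i : Fin N => i.val < M - 1).card = M - 1 := by
    rw [Fin.card_filter_val_lt]
    omega
  rw [h2] at h1
  simp only [Finset.card_univ, Fintype.card_fin] at h1
  omega

lemma card_col_row (hM : 0 < M) (hMN : M ≤ N) (j : Fin M) :
    (Finset.univ.filter fun z : Fin N × Fin M × Bool => z.2.1 = j ∧ ¬ (z.1.val < M - 1)).card
      = 2 * (N - M + 1) := by
  have : (Finset.univ.filter fun z : Fin N × Fin M × Bool => z.2.1 = j ∧ ¬ (z.1.val < M - 1)) =
      (Finset.univ.filter fun i : Fin N => ¬ (i.val < M - 1)) ×ˢ ({j} ×ˢ Finset.univ) := by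
    ext ⟨a, b, c⟩
    cases c <;> simp [and_comm]
  rw [this, Finset.card_product, Finset.card_product, card_row hM hMN]
  simp [mul_comm]

lemma strip_upper (v : Fin M → ℂ) (j : Fin M) (hj : v j = 1) (t : ℝ) (ht : 0 ≤ t) :
    muI (Fin N × Fin M × Bool) {g | ∀ i b, |lin v g i b| ≤ t} ≤ ENNReal.ofReal ((2 * t) ^ (2 * N)) := by
  apply fub_upper (fun z : Fin N × Fin M × Bool => z.2.1 = j)
  · apply IsClosed.measurableSet
    have : {g : (Fin N × Fin M × Bool) → ℝ | ∀ i b, |lin v g i b| ≤ t} =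
        ⋂ i, ⋂ b, {g | |lin v g i b| ≤ t} := by
      ext g; simp
    rw [this]
    apply isClosed_iInter; intro i
    apply isClosed_iInter; intro b
    exact isClosed_le (continuous_lin v i b).abs continuous_const
  intro g'
  rw [ENNReal.ofReal_pow (by positivity), ← card_col (N := N) j]
  refine le_trans (measure_mono ?_) (box_upper (fun z : Fin N × Fin M × Bool => z.2.1 = j)
    (fun z => Icc ((g' (z.1, j, z.2.2) - lin v g' z.1 z.2.2) - t)
      ((g' (z.1, j, z.2.2) - lin v g' z.1 z.2.2) + t)) _ ?_)
  · rintro g hg ⟨i, k, b⟩ hk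
    simp only at hk
    subst hk
    have h1 := hg i b
    have h2 := lin_diff v k hj (mrg (fun z : Fin N × Fin M × Bool => z.2.1 = k) g g') g' i
      (fun k' b' hk' => by simp [mrg, hk']) b
    have h3 : mrg (fun z : Fin N × Fin M × Bool => z.2.1 = k) g g' (i, k, b) = g (i, k, b) := by
      simp [mrg]
    rw [h3] at h2
    rw [abs_le] at h1
    simp only [mem_Icc]
    constructor <;> linarith [h1.1, h1.2]
  · intro z _
    exact mu0_upper _ _ ht

def gridF (M n : ℕ) (j : Fin M) : Finset (Fin M → ℤ × ℤ) :=
  Fintype.piFinset fun k => if k = j then {((n : ℤ), 0)} else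
    Finset.Icc (-(n : ℤ)) n ×ˢ Finset.Icc (-(n : ℤ)) n

lemma card_gridF (n : ℕ) (j : Fin M) : (gridF M n j).card = ((2 * n + 1) ^ 2) ^ (M - 1) := by
  rw [gridF, Fintype.card_piFinset, ← Finset.mul_prod_erase _ _ (Finset.mem_univ j)]
  rw [Finset.prod_congr rfl (g := fun _ => (2 * n + 1) ^ 2)]
  · simp
  · intro k hk
    rw [if_neg (Finset.ne_of_mem_erase hk), Finset.card_product, Int.card_Icc]
    have : ((n : ℤ) + 1 - -(n : ℤ)).toNat = 2 * n + 1 := by omega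
    rw [this]; ring

def gvec (n : ℕ) (f : Fin M → ℤ × ℤ) : Fin M → ℂ :=
  fun k => ⟨(f k).1 / n, (f k).2 / n⟩

lemma floor_approx (n : ℕ) (hn : 0 < n) (x : ℝ) (hx : |x| ≤ 1) :
    ⌊n * x⌋ ∈ Finset.Icc (-(n : ℤ)) n ∧ |x - (⌊n * x⌋ : ℝ) / n| ≤ 1 / n := by
  have hn' : (0 : ℝ) < n := by exact_mod_cast hn
  rw [abs_le] at hx
  have h1 := Int.floor_le ((n : ℝ) * x)
  have h2 := Int.lt_floor_add_one ((n : ℝ) * x)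
  refine ⟨Finset.mem_Icc.2 ⟨?_, ?_⟩, ?_⟩
  · apply Int.le_floor.2; push_cast; nlinarith
  · have : (⌊(n : ℝ) * x⌋ : ℝ) ≤ n := by nlinarith
    exact_mod_cast this
  · have : x - (⌊n * x⌋ : ℝ) / n = (n * x - ⌊n * x⌋) / n := by field_simp
    rw [this, abs_div, abs_of_pos hn']
    gcongr
    rw [abs_le]; constructor <;> linarith

lemma grid_approx (n : ℕ) (hn : 0 < n) (j : Fin M) (v : Fin M → ℂ) (hj : v j = 1)
    (hv : ∀ k, ‖v k‖ ≤ 1) : ∃ f ∈ gridF M n j, ∀ k, ‖(gvec n f - v) k‖ ≤ 2 / n := by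
  have hn' : (0 : ℝ) < n := by exact_mod_cast hn
  refine ⟨fun k => if k = j then ((n : ℤ), 0) else (⌊n * (v k).re⌋, ⌊n * (v k).im⌋), ?_, ?_⟩
  · rw [gridF, Fintype.mem_piFinset]
    intro k
    by_cases hk : k = j
    · simp [hk]
    · simp only [hk, if_false, Finset.mem_product]
      exact ⟨(floor_approx n hn _ ((Complex.abs_re_le_norm _).trans (hv k))).1,
        (floor_approx n hn _ ((Complex.abs_im_le_norm _).trans (hv k))).1⟩
  · intro k
    by_cases hk : k = j
    · subst hk
      have : (gvec n (fun k' => if k' = k then ((n : ℤ), 0) else (⌊n * (v k').re⌋, ⌊n * (v k').im⌋)) - v) k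
          = 0 := by
        apply Complex.ext <;> simp [gvec, hj, hn'.ne']
      rw [this, norm_zero]; positivity
    · refine (Complex.norm_le_abs_re_add_abs_im _).trans ?_
      have h1 := (floor_approx n hn _ ((Complex.abs_re_le_norm _).trans (hv k))).2
      have h2 := (floor_approx n hn _ ((Complex.abs_im_le_norm _).trans (hv k))).2
      rw [abs_sub_comm] at h1 h2
      simp only [Pi.sub_apply, gvec, hk, if_false, Complex.sub_re, Complex.sub_im]
      have : (2 : ℝ) / n = 1 / n + 1 / n := by ring
      linarith

lemma gvec_j (n : ℕ) (hn : 0 < n) (j : Fin M) (f) (hf : f ∈ gridF M n j) : gvec n f j = 1 := by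
  have hn' : (n : ℝ) ≠ 0 := by exact_mod_cast hn.ne'
  rw [gridF, Fintype.mem_piFinset] at hf
  have := hf j
  simp only [if_true, Finset.mem_singleton] at this
  apply Complex.ext <;> simp [gvec, this, hn']

lemma upper_bound (hM : 0 < M) (hMN : M ≤ N) : ∃ K : ℝ, 0 < K ∧ ∀ r : ℝ, 0 < r → r ≤ 1 →
    ∀ E : Set ((Fin N × Fin M × Bool) → ℝ),
    (∀ g ∈ E, (∀ i k, ‖matOf g i k‖ ≤ 1) ∧ ∃ v : Fin M → ℂ, v ≠ 0 ∧
      ∑ i, ‖(matOf g *ᵥ v) i‖ ^ 2 ≤ r ^ 2 / M * ∑ k, ‖v k‖ ^ 2) →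
    muI _ E ≤ ENNReal.ofReal (K * r ^ (2 * (N - M + 1))) := by
  have hM' : (0 : ℝ) < M := by exact_mod_cast hM
  refine ⟨M * (6 ^ 2) ^ (M - 1) * (2 * (1 + 2 * M)) ^ (2 * N), by positivity, ?_⟩
  intro r hr hr1 E hE
  set n := ⌈1 / r⌉₊ with hn
  have hnpos : 0 < n := Nat.ceil_pos.2 (by positivity)
  have hn' : (0 : ℝ) < n := by exact_mod_cast hnpos
  have hn1 : 1 / (n : ℝ) ≤ r := by
    have := Nat.le_ceil (1 / r)
    rw [div_le_iff₀ hn']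
    rw [div_le_iff₀ hr] at this
    linarith
  have hn2 : (n : ℝ) * r ≤ 2 := by
    have := (Nat.ceil_lt_add_one (a := 1 / r) (by positivity)).le
    calc (n : ℝ) * r ≤ (1 / r + 1) * r := by gcongr
      _ = 1 + r := by field_simp
      _ ≤ 2 := by linarith
  set t := (1 + 2 * M) * r with ht
  have hsub : E ⊆ ⋃ j ∈ (Finset.univ : Finset (Fin M)), ⋃ f ∈ gridF M n j,
      {g | ∀ i b, |lin (gvec n f) g i b| ≤ t} := by
    intro g hg
    obtain ⟨h1, v, hv0, hv⟩ := hE g hg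
    obtain ⟨j, a, ha, hj, hk⟩ := normalize_vec v hv0
    obtain ⟨f, hf, hfa⟩ := grid_approx n hnpos j (a • v) hj hk
    simp only [mem_iUnion]
    refine ⟨j, Finset.mem_univ _, f, hf, ?_⟩
    intro i b
    refine (abs_lin_le _ _ _ _).trans ?_
    have e1 : gvec n f = a • v + (gvec n f - a • v) := by abel
    rw [e1, Matrix.mulVec_add, Pi.add_apply]
    refine (norm_add_le _ _).trans ?_
    have b1 := norm_mulVec_le (matOf g) (gvec n f - a • v) i 1 (2 / n) zero_le_one (h1 i) hfa
    have b2 : ‖(matOf g *ᵥ (a • v)) i‖ ≤ r := by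
      apply abs_le_of_sq_le_sq' _ hr.le |>.2
      calc ‖(matOf g *ᵥ (a • v)) i‖ ^ 2 ≤ ∑ i, ‖(matOf g *ᵥ (a • v)) i‖ ^ 2 :=
            Finset.single_le_sum (f := fun i => ‖(matOf g *ᵥ (a • v)) i‖ ^ 2)
              (fun _ _ => by positivity) (Finset.mem_univ i)
        _ = ‖a‖ ^ 2 * ∑ i, ‖(matOf g *ᵥ v) i‖ ^ 2 := by
            rw [Finset.mul_sum]
            simp [Matrix.mulVec_smul, mul_pow]
        _ ≤ ‖a‖ ^ 2 * (r ^ 2 / M * ∑ k, ‖v k‖ ^ 2) := by gcongr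
        _ = r ^ 2 / M * ∑ k, ‖(a • v) k‖ ^ 2 := by
            simp only [Pi.smul_apply, smul_eq_mul, norm_mul, mul_pow, ← Finset.mul_sum]
            ring
        _ ≤ r ^ 2 / M * ∑ k : Fin M, (1 : ℝ) := by
            gcongr with k
            exact pow_le_one₀ (norm_nonneg _) (hk k)
        _ = r ^ 2 := by simp; field_simp
    have b3 : (M : ℝ) * (1 * (2 / n)) ≤ 2 * M * r := by
      have : (2 : ℝ) / n = 2 * (1 / n) := by ring
      rw [this]; nlinarith
    rw [ht]; linarith
  refine (measure_mono hsub).trans ?_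
  refine (measure_biUnion_finset_le _ _).trans ?_
  have step : ∀ j ∈ (Finset.univ : Finset (Fin M)),
      muI _ (⋃ f ∈ gridF M n j, {g : (Fin N × Fin M × Bool) → ℝ | ∀ i b, |lin (gvec n f) g i b| ≤ t})
      ≤ ENNReal.ofReal ((((2 * n + 1) ^ 2) ^ (M - 1) : ℝ) * (2 * t) ^ (2 * N)) := by
    intro j _
    refine (measure_biUnion_finset_le _ _).trans ?_
    refine (Finset.sum_le_card_nsmul _ _ (ENNReal.ofReal ((2 * t) ^ (2 * N))) ?_).trans ?_
    · intro f hf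
      exact strip_upper _ j (gvec_j n hnpos j f hf) t (by positivity)
    · rw [card_gridF, nsmul_eq_mul, ENNReal.ofReal_mul (by positivity)]
      gcongr
      rw [← ENNReal.ofReal_natCast]
      push_cast
      rfl
  refine (Finset.sum_le_card_nsmul _ _ _ step).trans ?_
  rw [nsmul_eq_mul, Finset.card_univ, Fintype.card_fin, ← ENNReal.ofReal_natCast,
    ← ENNReal.ofReal_mul (by positivity)]
  apply ENNReal.ofReal_le_ofReal
  have e : r ^ (2 * N) = r ^ (2 * (N - M + 1)) * (r ^ 2) ^ (M - 1) := by
    rw [← pow_mul, ← pow_add]; congr 1; omega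
  have h6 : ((2 * n + 1 : ℝ) ^ 2) ^ (M - 1) * (r ^ 2) ^ (M - 1) ≤ (6 ^ 2) ^ (M - 1) := by
    rw [← mul_pow, ← mul_pow]
    have h1n : (1 : ℝ) ≤ n := by exact_mod_cast hnpos
    have : (2 * n + 1 : ℝ) * r ≤ 6 := by nlinarith
    gcongr
  calc (M : ℝ) * (((2 * n + 1 : ℝ) ^ 2) ^ (M - 1) * (2 * t) ^ (2 * N))
      = M * (2 * (1 + 2 * M)) ^ (2 * N) * r ^ (2 * (N - M + 1)) *
        (((2 * n + 1 : ℝ) ^ 2) ^ (M - 1) * (r ^ 2) ^ (M - 1)) := by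
        rw [ht, show 2 * ((1 + 2 * (M : ℝ)) * r) = (2 * (1 + 2 * M)) * r by ring, mul_pow, e]; ring
    _ ≤ M * (2 * (1 + 2 * M)) ^ (2 * N) * r ^ (2 * (N - M + 1)) * (6 ^ 2) ^ (M - 1) := by gcongr
    _ = _ := by ring

lemma null_vec (hM : 0 < M) (hMN : M ≤ N) (H : Matrix (Fin N) (Fin M) ℂ) :
    ∃ v : Fin M → ℂ, v ≠ 0 ∧ ∀ i : Fin N, i.val < M - 1 → (H *ᵥ v) i = 0 := by
  let T : Matrix (Fin M) (Fin M) ℂ := fun i k =>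
    if i.val < M - 1 then H ⟨i.val, by omega⟩ k else 0
  have hT : T.det = 0 := Matrix.det_eq_zero_of_row_eq_zero ⟨M - 1, by omega⟩ (fun k => by simp [T])
  obtain ⟨v, hv, h⟩ := Matrix.exists_mulVec_eq_zero_iff.2 hT
  refine ⟨v, hv, fun i hi => ?_⟩
  have := congrFun h ⟨i.val, by omega⟩
  simpa [T, Matrix.mulVec, dotProduct, hi] using this

lemma lower_bound (hM : 0 < M) (hMN : M ≤ N) : ∃ K : ℝ, 0 < K ∧ ∀ r : ℝ, 0 < r → r ≤ 1 →
    ENNReal.ofReal (K * r ^ (2 * (N - M + 1))) ≤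
    muI (Fin N × Fin M × Bool) {g | (∀ z, |g z| ≤ 1 / (8 * N * M)) ∧ ∃ v : Fin M → ℂ, (∃ j, v j = 1) ∧
      ∀ i b, |lin v g i b| ≤ r * (1 / (8 * N * M))} := by
  have hM' : (1 : ℝ) ≤ M := by exact_mod_cast hM
  have hN' : (1 : ℝ) ≤ N := by exact_mod_cast (hM.trans_le hMN)
  obtain ⟨k0, hk0, hlow⟩ := mu0_lower
  set s : ℝ := 1 / (8 * N * M) with hs
  have hspos : 0 < s := by positivity
  have hs1 : s ≤ 1 := by
    rw [hs, div_le_one (by positivity)]; nlinarith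
  set s2 : ℝ := s / (6 * M) with hs2
  have hs2pos : 0 < s2 := by positivity
  have hs2M : 6 * M * s2 = s := by rw [hs2]; field_simp
  have hs2s : s2 ≤ s := by nlinarith
  set c := Fintype.card (Fin N × Fin M × Bool)
  have boxall : ∀ u : ℝ, 0 < u → u ≤ 1 → ENNReal.ofReal ((k0 * u) ^ c) ≤
      muI (Fin N × Fin M × Bool) {g | ∀ z, True → g z ∈ Icc (0 - u) (0 + u)} := by
    intro u hu hu1
    have := box_lower (fun _ : Fin N × Fin M × Bool => True) (fun _ => Icc (0 - u) (0 + u))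
      (ENNReal.ofReal (k0 * u)) (fun _ _ => hlow 0 u (by simp) hu.le hu1)
    rw [ENNReal.ofReal_pow (by positivity)]
    simpa [c] using this
  have boxmeas : ∀ u : ℝ, MeasurableSet
      {g : (Fin N × Fin M × Bool) → ℝ | ∀ z, True → g z ∈ Icc (0 - u) (0 + u)} := by
    intro u
    have : {g : (Fin N × Fin M × Bool) → ℝ | ∀ z, True → g z ∈ Icc (0 - u) (0 + u)} =
        Set.univ.pi fun _ => Icc (0 - u) (0 + u) := by
      ext g
      exact ⟨fun h z _ => h z trivial, fun h z _ => h z (mem_univ z)⟩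
    rw [this]
    exact MeasurableSet.univ_pi fun _ => measurableSet_Icc
  refine ⟨(k0 * (s / 2)) ^ (2 * (N - M + 1)) * (k0 * s2) ^ c * (k0 * s) ^ c, by positivity, ?_⟩
  intro r hr hr1
  set A := {g : (Fin N × Fin M × Bool) → ℝ | (∀ z, |g z| ≤ s) ∧ ∃ v : Fin M → ℂ, (∃ j, v j = 1) ∧
      ∀ i b, |lin v g i b| ≤ r * s} with hA
  set t := r * (s / 2) with ht
  have htpos : 0 < t := by positivity
  have hts : t ≤ s / 2 := by nlinarith
  have main : ENNReal.ofReal ((k0 * t) ^ (2 * (N - M + 1)) * (k0 * s2) ^ c) *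
      muI _ {g : (Fin N × Fin M × Bool) → ℝ | ∀ z, True → g z ∈ Icc (0 - s) (0 + s)} ≤ muI _ A := by
    apply fub_lower (fun z : Fin N × Fin M × Bool => ¬ (z.1.val < M - 1)) A _ (boxmeas s)
    intro g' hg'
    obtain ⟨v0, hv0, hnull⟩ := null_vec hM hMN (matOf g')
    obtain ⟨j, a, ha, hj, hv⟩ := normalize_vec v0 hv0
    set v := a • v0 with hvdef
    have hnull' : ∀ i : Fin N, i.val < M - 1 → ∀ b, lin v g' i b = 0 := by
      intro i hi b
      have : (matOf g' *ᵥ v) i = 0 := by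
        rw [hvdef, Matrix.mulVec_smul, Pi.smul_apply, hnull i hi, smul_zero]
      simp [lin, this]
    rw [ENNReal.ofReal_mul (by positivity)]
    refine le_trans (mul_le_mul_right (boxall s2 hs2pos (hs2s.trans hs1)) _) ?_
    apply fub_lower (fun z : Fin N × Fin M × Bool => z.2.1 = j ∧ ¬ (z.1.val < M - 1)) _ _ (boxmeas s2)
    intro g'' hg''
    have hg2 : ∀ z, |g'' z| ≤ s2 := by
      intro z
      have := hg'' z trivial
      rw [abs_le]; constructor <;> linarith [this.1, this.2]
    have hg1 : ∀ z, |g' z| ≤ s := by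
      intro z
      have := hg' z trivial
      rw [abs_le]; constructor <;> linarith [this.1, this.2]
    have hc : ∀ i b, |g'' (i, j, b) - lin v g'' i b| ≤ s / 2 := by
      intro i b
      have h1 := norm_mulVec_le (matOf g'') v i (2 * s2) 1 (by positivity)
        (fun k => norm_matOf_le g'' i k s2 (fun b => hg2 _)) hv
      have h2 := (abs_lin_le v g'' i b).trans h1
      refine (abs_sub _ _).trans ?_
      have := hg2 (i, j, b)
      nlinarith
    rw [ENNReal.ofReal_pow (by positivity), ← card_col_row hM hMN j]
    refine le_trans (box_lower (fun z : Fin N × Fin M × Bool => z.2.1 = j ∧ ¬ (z.1.val < M - 1))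
      (fun z => Icc ((g'' (z.1, j, z.2.2) - lin v g'' z.1 z.2.2) - t)
      ((g'' (z.1, j, z.2.2) - lin v g'' z.1 z.2.2) + t)) (ENNReal.ofReal (k0 * t)) ?_) (measure_mono ?_)
    · intro z _
      exact hlow _ _ ((hc _ _).trans (by linarith)) htpos.le (by linarith)
    · intro g hg
      set m := mrg (fun z : Fin N × Fin M × Bool => ¬ (z.1.val < M - 1))
        (mrg (fun z : Fin N × Fin M × Bool => z.2.1 = j ∧ ¬ (z.1.val < M - 1)) g g'') g' with hm
      change m ∈ A
      have mtop : ∀ i k b, i.val < M - 1 → m (i, k, b) = g' (i, k, b) := by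
        intro i k b hi
        simp [hm, mrg, hi]
      have mbot : ∀ i k b, ¬ (i.val < M - 1) → k ≠ j → m (i, k, b) = g'' (i, k, b) := by
        intro i k b hi hk
        simp [hm, mrg, hk]
        omega
      have mpiv : ∀ i b, ¬ (i.val < M - 1) → m (i, j, b) = g (i, j, b) := by
        intro i b hi
        simp only [hm, mrg, hi, not_false_eq_true, if_true, and_self]
      have hgI : ∀ i b, ¬ (i.val < M - 1) →
          |g (i, j, b) - (g'' (i, j, b) - lin v g'' i b)| ≤ t := by
        intro i b hi
        have := hg (i, j, b) ⟨rfl, hi⟩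
        simp only [mem_Icc] at this
        rw [abs_le]; constructor <;> linarith [this.1, this.2]
      refine ⟨?_, v, ⟨j, hj⟩, ?_⟩
      · rintro ⟨i, k, b⟩
        by_cases hi : i.val < M - 1
        · rw [mtop i k b hi]; exact hg1 _
        · by_cases hk : k = j
          · subst hk
            rw [mpiv i b hi]
            have h1 := hgI i b hi
            have h2 := hc i b
            rw [abs_le] at h1 h2 ⊢
            constructor <;> linarith [h1.1, h1.2, h2.1, h2.2]
          · rw [mbot i k b hi hk]; exact (hg2 _).trans hs2s
      · intro i b
        by_cases hi : i.val < M - 1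
        · rw [lin_congr v m g' i (fun k b => mtop i k b hi), hnull' i hi, abs_zero]
          positivity
        · have h1 := lin_diff v j hj m g'' i (fun k b hk => mbot i k b hi hk) b
          rw [mpiv i b hi] at h1
          have h2 := hgI i b hi
          have h3 : lin v m i b = g (i, j, b) - (g'' (i, j, b) - lin v g'' i b) := by linarith
          rw [h3]
          refine h2.trans ?_
          rw [ht]; nlinarith
  refine le_trans ?_ main
  refine le_trans ?_ (mul_le_mul_right (boxall s hspos hs1) _)
  rw [← ENNReal.ofReal_mul (by positivity)]
  apply ENNReal.ofReal_le_ofReal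
  apply le_of_eq
  rw [ht, show k0 * (r * (s / 2)) = (k0 * (s / 2)) * r by ring, mul_pow]
  ring

end bounds

lemma log_limit (F : ℝ → ℝ) (p : ℕ) (K1 K2 : ℝ) (h1 : 0 < K1) (h2 : 0 < K2)
    (hl : ∀ ε, 0 < ε → ε ≤ 1 → K1 * ε ^ p ≤ F ε) (hu : ∀ ε, 0 < ε → ε ≤ 1 → F ε ≤ K2 * ε ^ p) :
    Tendsto (fun ε => Real.log (F ε) / Real.log ε) (nhdsWithin 0 (Set.Ioi 0)) (nhds (p : ℝ)) := by
  have hlim : ∀ K : ℝ, Tendsto (fun ε => Real.log K / Real.log ε + p) (nhdsWithin 0 (Set.Ioi 0))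
      (nhds (p : ℝ)) := by
    intro K
    have : Tendsto (fun ε => Real.log K / Real.log ε) (nhdsWithin 0 (Set.Ioi 0)) (nhds 0) :=
      Tendsto.const_div_atBot Real.tendsto_log_nhdsGT_zero _
    simpa using this.add_const (p : ℝ)
  have hev : ∀ᶠ ε : ℝ in nhdsWithin 0 (Set.Ioi 0), 0 < ε ∧ ε < 1 := by
    have := Ioo_mem_nhdsGT (show (0 : ℝ) < 1 by norm_num)
    filter_upwards [this] with ε hε using hε
  have key : ∀ K ε : ℝ, 0 < K → 0 < ε → ε < 1 →
      Real.log K / Real.log ε + p = Real.log (K * ε ^ p) / Real.log ε := by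
    intro K ε hK he he1
    have : Real.log ε ≠ 0 := (Real.log_neg he he1).ne
    rw [Real.log_mul hK.ne' (by positivity), Real.log_pow]
    field_simp
  refine tendsto_of_tendsto_of_tendsto_of_le_of_le' (hlim K2) (hlim K1) ?_ ?_
  · filter_upwards [hev] with ε hε
    rw [key _ _ h2 hε.1 hε.2]
    apply div_le_div_of_nonpos_of_le (Real.log_neg hε.1 hε.2).le
    apply Real.log_le_log _ (hu ε hε.1 hε.2.le)
    have := hε.1
    exact lt_of_lt_of_le (by positivity) (hl ε hε.1 hε.2.le)
  · filter_upwards [hev] with ε hε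
    rw [key _ _ h1 hε.1 hε.2]
    apply div_le_div_of_nonpos_of_le (Real.log_neg hε.1 hε.2).le
    have := hε.1
    exact Real.log_le_log (by positivity) (hl ε hε.1 hε.2.le)

end aux

/-- Let `H` be an `N × M` random matrix (`M ≤ N`) with i.i.d.
circularly-symmetric complex Gaussian entries of zero mean and unit variance, with ordered
singular values `σ₁ ≤ … ≤ σ_M` (encoded by `σs`: monotone, nonnegative, and with squares
the roots of the characteristic polynomial of `HᴴH`).  Then
`lim_{ε→0⁺} log Pr{σ₁ ≤ ε^M/(4√M), σᵢ ≤ 1/(4√M) for i > 1} / log ε = 2M(N−M+1)`. -/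
theorem singular_values_event_exponent
    (M N : ℕ) (hM : 0 < M) (hMN : M ≤ N)
    (σs : ((Fin N × Fin M × Bool) → ℝ) → Fin M → ℝ)
    (hmono : ∀ g, Monotone (σs g))
    (hnonneg : ∀ g i, 0 ≤ σs g i)
    (hchar : ∀ g, ((matOf g).conjTranspose * matOf g).charpoly =
        ∏ i, (Polynomial.X - Polynomial.C ((σs g i : ℂ) ^ 2))) :
    Filter.Tendsto (fun ε : ℝ =>
        Real.log (((gaussMatMeasure N M)
            {g | σs g ⟨0, hM⟩ ≤ ε ^ M / (4 * Real.sqrt M) ∧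
              ∀ i, i ≠ ⟨0, hM⟩ → σs g i ≤ 1 / (4 * Real.sqrt M)}).toReal) / Real.log ε)
      (nhdsWithin 0 (Set.Ioi 0))
      (nhds (2 * (M : ℝ) * ((N : ℝ) - (M : ℝ) + 1))) := by
  have hM' : (1 : ℝ) ≤ M := by exact_mod_cast hM
  have hN' : (1 : ℝ) ≤ N := by exact_mod_cast (hM.trans_le hMN)
  have hMN' : (M : ℝ) ≤ N := by exact_mod_cast hMN
  obtain ⟨K2, hK2, hupper⟩ := upper_bound hM hMN
  obtain ⟨K1, hK1, hlower⟩ := lower_bound hM hMN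
  have hp : (2 * (M : ℝ) * ((N : ℝ) - (M : ℝ) + 1)) = ((M * (2 * (N - M + 1)) : ℕ) : ℝ) := by
    push_cast [Nat.cast_sub hMN]; ring
  rw [hp]
  have hsq : (0 : ℝ) < Real.sqrt M := Real.sqrt_pos.2 (by linarith)
  have hsqM : Real.sqrt M ^ 2 = (M : ℝ) := Real.sq_sqrt (by linarith)
  have hfin : ∀ E, gaussMatMeasure N M E ≠ ⊤ := by
    intro E
    unfold gaussMatMeasure
    exact measure_ne_top _ _
  apply log_limit _ _ K1 K2 hK1 hK2
  · intro ε he he1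
    rw [pow_mul]
    have hr1 : ε ^ M ≤ 1 := pow_le_one₀ he.le he1
    have hr : 0 < ε ^ M := by positivity
    rw [← ENNReal.ofReal_le_iff_le_toReal (hfin _)]
    refine (hlower (ε ^ M) hr hr1).trans ?_
    unfold gaussMatMeasure
    apply measure_mono
    rintro g ⟨hg, v, ⟨j, hj⟩, hv⟩
    set s : ℝ := 1 / (8 * N * M) with hs
    have hspos : 0 < s := by positivity
    have hsM : 8 * N * M * s = 1 := by rw [hs]; field_simp
    have hsq2 : (1 / (4 * Real.sqrt M)) ^ 2 = 1 / (16 * M) := by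
      rw [div_pow, mul_pow, hsqM]; norm_num
    have hNs : N * (2 * s ^ 2) * (16 * M) ≤ 1 := by
      have h1 : N * (2 * s ^ 2) * (16 * M) = 4 * s * (8 * N * M * s) := by ring
      rw [h1, hsM]
      have : (1 : ℝ) ≤ N * M := by nlinarith
      nlinarith
    have hNs' : N * (M * (2 * s ^ 2)) * (16 * M) ≤ 1 := by
      have h1 : N * (M * (2 * s ^ 2)) * (16 * M) = 4 * s * M * (8 * N * M * s) := by ring
      rw [h1, hsM]
      have : M * s ≤ N * M * s := by
        have : (0 : ℝ) ≤ M * s := by positivity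
        nlinarith
      nlinarith
    have hall : ∀ i, σs g i ≤ 1 / (4 * Real.sqrt M) := by
      intro i
      apply abs_le_of_sq_le_sq' _ (by positivity) |>.2
      rw [hsq2]
      calc σs g i ^ 2 ≤ ∑ i, σs g i ^ 2 :=
            Finset.single_le_sum (f := fun i => σs g i ^ 2) (fun _ _ => by positivity) (Finset.mem_univ i)
        _ = ∑ i, ∑ k, ‖matOf g i k‖ ^ 2 := (sum_sq_eq _ _ (hchar g)).symm
        _ ≤ ∑ i : Fin N, ∑ k : Fin M, 2 * s ^ 2 := by
            gcongr with i _ k _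
            rw [← Complex.normSq_eq_norm_sq, Complex.normSq_apply, matOf_re, matOf_im]
            have h1 := sq_le_sq' (abs_le.1 (hg (i, k, false))).1 (abs_le.1 (hg (i, k, false))).2
            have h2 := sq_le_sq' (abs_le.1 (hg (i, k, true))).1 (abs_le.1 (hg (i, k, true))).2
            nlinarith
        _ = N * (M * (2 * s ^ 2)) := by simp
        _ ≤ 1 / (16 * M) := by rw [le_div_iff₀ (by positivity)]; exact hNs'
    refine ⟨?_, fun i _ => hall i⟩
    apply abs_le_of_sq_le_sq' _ (by positivity) |>.2
    have h0 : ∀ i, σs g ⟨0, hM⟩ ^ 2 ≤ σs g i ^ 2 := by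
      intro i
      have := hmono g (show (⟨0, hM⟩ : Fin M) ≤ i from Nat.zero_le _)
      have := hnonneg g ⟨0, hM⟩
      gcongr
    have h1 := rayleigh (matOf g) (σs g) (hchar g) _ h0 v
    have h2 : 1 ≤ ∑ k, ‖v k‖ ^ 2 := by
      have := Finset.single_le_sum (f := fun k => ‖v k‖ ^ 2) (fun _ _ => by positivity) (Finset.mem_univ j)
      simpa [hj] using this
    have h3 : ∑ i, ‖(matOf g *ᵥ v) i‖ ^ 2 ≤ (ε ^ M) ^ 2 * (N * (2 * s ^ 2)) := by
      calc ∑ i, ‖(matOf g *ᵥ v) i‖ ^ 2 ≤ ∑ i : Fin N, 2 * (ε ^ M * s) ^ 2 := by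
            gcongr with i _
            rw [norm_sq_lin]
            have h1 := sq_le_sq' (abs_le.1 (hv i false)).1 (abs_le.1 (hv i false)).2
            have h2 := sq_le_sq' (abs_le.1 (hv i true)).1 (abs_le.1 (hv i true)).2
            linarith
        _ = _ := by simp; ring
    have h4 : N * (2 * s ^ 2) ≤ 1 / (16 * M) := by rw [le_div_iff₀ (by positivity)]; exact hNs
    calc σs g ⟨0, hM⟩ ^ 2 ≤ σs g ⟨0, hM⟩ ^ 2 * ∑ k, ‖v k‖ ^ 2 := le_mul_of_one_le_right (by positivity) h2
      _ ≤ (ε ^ M) ^ 2 * (N * (2 * s ^ 2)) := h1.trans h3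
      _ ≤ (ε ^ M) ^ 2 * (1 / (16 * M)) := by gcongr
      _ = (ε ^ M / (4 * Real.sqrt M)) ^ 2 := by rw [← hsq2]; ring
  · intro ε he he1
    rw [pow_mul]
    have hr1 : ε ^ M ≤ 1 := pow_le_one₀ he.le he1
    have hr : 0 < ε ^ M := by positivity
    apply ENNReal.toReal_le_of_le_ofReal (by positivity)
    apply hupper (ε ^ M) hr hr1
    rintro g ⟨hg0, hg⟩
    have hsq2 : (1 / (4 * Real.sqrt M)) ^ 2 = 1 / (16 * M) := by
      rw [div_pow, mul_pow, hsqM]; norm_num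
    have hall : ∀ i, σs g i ≤ 1 / (4 * Real.sqrt M) := by
      intro i
      by_cases hi : i = ⟨0, hM⟩
      · subst hi
        refine hg0.trans ?_
        gcongr
      · exact hg i hi
    constructor
    · intro i k
      apply abs_le_of_sq_le_sq' _ zero_le_one |>.2
      calc ‖matOf g i k‖ ^ 2 ≤ ∑ k, ‖matOf g i k‖ ^ 2 :=
            Finset.single_le_sum (f := fun k => ‖matOf g i k‖ ^ 2) (fun _ _ => by positivity) (Finset.mem_univ k)
        _ ≤ ∑ i, ∑ k, ‖matOf g i k‖ ^ 2 :=
            Finset.single_le_sum (f := fun i => ∑ k, ‖matOf g i k‖ ^ 2) (fun _ _ => by positivity) (Finset.mem_univ i)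
        _ = ∑ i, σs g i ^ 2 := sum_sq_eq _ _ (hchar g)
        _ ≤ ∑ i : Fin M, 1 / (16 * (M : ℝ)) := by
            gcongr with i _
            rw [← hsq2]
            have := hnonneg g i
            have := hall i
            gcongr
        _ ≤ 1 ^ 2 := by
            simp
            field_simp
            norm_num
    · obtain ⟨v, hv0, hv⟩ := exists_vec (matOf g) (σs g) (hchar g) ⟨0, hM⟩
      refine ⟨v, hv0, ?_⟩
      rw [hv]
      gcongr
      have := hnonneg g ⟨0, hM⟩
      calc σs g ⟨0, hM⟩ ^ 2 ≤ (ε ^ M / (4 * Real.sqrt M)) ^ 2 := by gcongr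
        _ = (ε ^ M) ^ 2 * (1 / (4 * Real.sqrt M)) ^ 2 := by ring
        _ = (ε ^ M) ^ 2 / M * (1 / 16) := by rw [hsq2]; field_simp
        _ ≤ (ε ^ M) ^ 2 / M := by
            have : 0 ≤ (ε ^ M) ^ 2 / (M : ℝ) := by positivity
            linarith
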